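/- Let f be a probability density function on ℝ that is positive everywhere, strictly log-concave (log f strictly concave), and has a finite mean, and let b ∈ ℝ. Then for every integer N ≥ 2 there exist unique real numbers m_1 < m_2 < ⋯ < m_{N−1} satisfying the equilibrium equations m_k = (E[M | m_{k−1} ≤ M < m_k] + E[M | m_k ≤ M < m_{k+1}])/2 + b for k = 1, …, N−1, where m_0 = −∞ and m_N = +∞. That is, for a log-concave source with two-sided unbounded support there exists a unique cheap-talk equilibrium with N bins for every N. -/

import Mathlib

open MeasureTheory Set

/-- Conditional mean `E[M | M ∈ s]` of a random variable with density `f`. -/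
noncomputable def condMean (f : ℝ → ℝ) (s : Set ℝ) : ℝ :=
  (∫ x in s, x * f x) / (∫ x in s, f x)

/-- The bin (interval) of real numbers between two extended-real edges `lo` and `hi`. -/
def ebin (lo hi : EReal) : Set ℝ := {x : ℝ | lo ≤ (x : EReal) ∧ (x : EReal) < hi}

/-- Edges `m_0 = −∞ < m_1 < ⋯ < m_{N−1} < m_N = +∞` of an `N`-bin quantizer with interior
edges `m : Fin (N−1) → ℝ`, for a source with two-sided unbounded support. -/
noncomputable def edges2 (N : ℕ) (m : Fin (N - 1) → ℝ) (k : ℕ) : EReal :=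
  if hk : k = 0 then ⊥
  else if h : k ≤ N - 1 then ((m ⟨k - 1, by omega⟩ : ℝ) : EReal)
  else ⊤

/-- `m : Fin (N−1) → ℝ` is the vector of interior edges of an `N`-bin cheap-talk equilibrium
for a source with density `f` (two-sided unbounded support) and bias `b`: the edges are
strictly increasing and every interior edge `m_k` satisfies
`m_k = (E[M | m_{k−1} ≤ M < m_k] + E[M | m_k ≤ M < m_{k+1}])/2 + b`
(centroid plus nearest-neighbor conditions), with `m_0 = −∞`, `m_N = +∞`. -/
def IsEq2 (f : ℝ → ℝ) (b : ℝ) (N : ℕ) (m : Fin (N - 1) → ℝ) : Prop :=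
  StrictMono m ∧ ∀ k : Fin (N - 1),
    m k = (condMean f (ebin (edges2 N m k.val) (edges2 N m (k.val + 1)))
         + condMean f (ebin (edges2 N m (k.val + 1)) (edges2 N m (k.val + 2)))) / 2 + b

section ConditionalMean

variable {f : ℝ → ℝ} {A B : Set ℝ}

lemma setIntegral_density_pos (hpos : ∀ x, 0 < f x) (hint : Integrable f)
    (hA : 0 < volume A) : 0 < ∫ x in A, f x := by
  rw [setIntegral_pos_iff_support_of_nonneg_ae
    (Filter.Eventually.of_forall fun x => (hpos x).le) hint.integrableOn]
  have : Function.support f = univ := by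
    ext x
    simpa using (hpos x).ne'
  simpa [this] using hA

lemma integrable_sub_mul (hint : Integrable f) (hmean : Integrable fun x => x * f x) (y : ℝ) :
    Integrable fun x => (x - y) * f x := by
  simp only [sub_mul]
  exact hmean.sub (hint.const_mul y)

lemma setIntegral_sub_mul (hpos : ∀ x, 0 < f x) (hint : Integrable f)
    (hmean : Integrable fun x => x * f x) (hA : 0 < volume A) (y : ℝ) :
    ∫ x in A, (x - y) * f x = (condMean f A - y) * ∫ x in A, f x := by
  have h := setIntegral_density_pos hpos hint hA
  simp only [sub_mul]
  rw [integral_sub hmean.integrableOn (hint.const_mul y).integrableOn, integral_const_mul,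
    condMean, div_mul_cancel₀ _ h.ne']

lemma condMean_lt_of_forall_lt (hpos : ∀ x, 0 < f x) (hint : Integrable f)
    (hmean : Integrable fun x => x * f x) (hAm : MeasurableSet A) (hA : 0 < volume A) {y : ℝ}
    (h : ∀ x ∈ A, x < y) : condMean f A < y := by
  have hI : 0 < ∫ x in A, -((x - y) * f x) := by
    rw [setIntegral_pos_iff_support_of_nonneg_ae _
      (integrable_sub_mul hint hmean y).fun_neg.integrableOn]
    · refine hA.trans_le (measure_mono fun x hx => ⟨?_, hx⟩)
      simp [sub_eq_zero, (h x hx).ne, (hpos x).ne']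
    · filter_upwards [ae_restrict_mem hAm] with x hx
      have := mul_pos (sub_pos.2 (h x hx)) (hpos x)
      simp only [Pi.zero_apply]
      linarith
  rw [integral_neg, setIntegral_sub_mul hpos hint hmean hA] at hI
  nlinarith [setIntegral_density_pos hpos hint hA]

lemma le_condMean_of_forall_le (hpos : ∀ x, 0 < f x) (hint : Integrable f)
    (hmean : Integrable fun x => x * f x) (hAm : MeasurableSet A) (hA : 0 < volume A) {y : ℝ}
    (h : ∀ x ∈ A, y ≤ x) : y ≤ condMean f A := by
  have hI : 0 ≤ ∫ x in A, (x - y) * f x :=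
    setIntegral_nonneg hAm fun x hx => mul_nonneg (sub_nonneg.2 (h x hx)) (hpos x).le
  rw [setIntegral_sub_mul hpos hint hmean hA] at hI
  nlinarith [setIntegral_density_pos hpos hint hA]

lemma condMean_le_condMean (hpos : ∀ x, 0 < f x) (hint : Integrable f)
    (hmean : Integrable fun x => x * f x) (hAm : MeasurableSet A) (hBm : MeasurableSet B)
    (hA : 0 < volume A) (hB : 0 < volume B)
    (hAB : ∀ x ∈ A, x ∉ B → x ≤ condMean f A) (hBA : ∀ x ∈ B, x ∉ A → condMean f A ≤ x) :
    condMean f A ≤ condMean f B := by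
  have hi := integrable_sub_mul hint hmean (condMean f A)
  have hI : ∫ x in A, (x - condMean f A) * f x ≤ ∫ x in B, (x - condMean f A) * f x := by
    rw [← integral_indicator hAm, ← integral_indicator hBm]
    refine integral_mono (hi.indicator hAm) (hi.indicator hBm) fun x => ?_
    by_cases ha : x ∈ A <;> by_cases hb : x ∈ B <;> simp only [indicator, ha, hb, if_true, if_false]
    · exact le_rfl
    · exact mul_nonpos_of_nonpos_of_nonneg (sub_nonpos.2 (hAB x ha hb)) (hpos x).le
    · exact mul_nonneg (sub_nonneg.2 (hBA x hb ha)) (hpos x).le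
    · exact le_rfl
  rw [setIntegral_sub_mul hpos hint hmean hA, setIntegral_sub_mul hpos hint hmean hB] at hI
  nlinarith [setIntegral_density_pos hpos hint hB]

lemma mul_lt_mul_of_strictConcaveOn_log (hpos : ∀ x, 0 < f x)
    (hslc : StrictConcaveOn ℝ univ fun x => Real.log (f x)) {x y t : ℝ} (ht : 0 < t)
    (hxy : x < y) : f x * f (y + t) < f (x + t) * f y := by
  have hd : 0 < y + t - x := by linarith
  have hne : x ≠ y + t := by linarith
  have ha : 0 < t / (y + t - x) := by positivity
  have hb : 0 < (y - x) / (y + t - x) := div_pos (by linarith) hd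
  have hab : t / (y + t - x) + (y - x) / (y + t - x) = 1 := by
    field_simp
    ring
  have h₁ := hslc.2 (mem_univ x) (mem_univ (y + t)) hne hb ha (by linarith)
  have h₂ := hslc.2 (mem_univ x) (mem_univ (y + t)) hne ha hb hab
  have e₁ : (y - x) / (y + t - x) * x + t / (y + t - x) * (y + t) = x + t := by
    field_simp
    ring
  have e₂ : t / (y + t - x) * x + (y - x) / (y + t - x) * (y + t) = y := by
    field_simp
    ring
  simp only [smul_eq_mul, e₁, e₂] at h₁ h₂
  have h : Real.log (f x) + Real.log (f (y + t)) < Real.log (f (x + t)) + Real.log (f y) := by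
    have : Real.log (f x) + Real.log (f (y + t)) =
        (t / (y + t - x) + (y - x) / (y + t - x)) * (Real.log (f x) + Real.log (f (y + t))) := by
      rw [hab, one_mul]
    rw [this]
    linarith
  rw [← Real.log_mul (hpos _).ne' (hpos _).ne', ← Real.log_mul (hpos _).ne' (hpos _).ne'] at h
  exact (Real.log_lt_log_iff (mul_pos (hpos _) (hpos _)) (mul_pos (hpos _) (hpos _))).1 h

/-- For a strictly log-concave density, translating the conditioning event to the right by `t`
raises the conditional mean by less than `t`. -/
lemma condMean_lt_condMean_preimage_add (hpos : ∀ x, 0 < f x) (hint : Integrable f)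
    (hmean : Integrable fun x => x * f x)
    (hslc : StrictConcaveOn ℝ univ fun x => Real.log (f x)) (hBm : MeasurableSet B) {t : ℝ}
    (ht : 0 < t) (hB : 0 < volume B) :
    condMean f B < condMean f ((fun x => x + t) ⁻¹' B) + t := by
  set A := (fun x => x + t) ⁻¹' B
  have hmp := measurePreserving_add_right (volume : Measure ℝ) t
  have hAm : MeasurableSet A := measurable_add_const t hBm
  have hA : 0 < volume A := by rwa [hmp.measure_preimage hBm.nullMeasurableSet]
  set c := condMean f A with hc
  have hi₁ := (integrable_sub_mul hint hmean c).const_mul (f (c + t))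
  have hi₂ := ((integrable_sub_mul hint hmean (c + t)).comp_add_right t).const_mul (f c)
  have hpt : ∀ x, x ≠ c →
      0 < f (c + t) * ((x - c) * f x) - f c * ((x + t - (c + t)) * f (x + t)) := by
    intro x hx
    have key : f (c + t) * ((x - c) * f x) - f c * ((x + t - (c + t)) * f (x + t)) =
        (x - c) * (f x * f (c + t) - f c * f (x + t)) := by ring
    rw [key]
    rcases lt_or_gt_of_ne hx with h | h
    · have := mul_lt_mul_of_strictConcaveOn_log hpos hslc ht h
      exact mul_pos_of_neg_of_neg (by linarith) (by linarith)
    · have := mul_lt_mul_of_strictConcaveOn_log hpos hslc ht h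
      exact mul_pos (by linarith) (by linarith)
  have hi₃ : Integrable fun x =>
      f (c + t) * ((x - c) * f x) - f c * ((x + t - (c + t)) * f (x + t)) := hi₁.sub hi₂
  have hI : 0 < ∫ x in A,
      (f (c + t) * ((x - c) * f x) - f c * ((x + t - (c + t)) * f (x + t))) := by
    rw [setIntegral_pos_iff_support_of_nonneg_ae _ hi₃.integrableOn]
    · have hAc : 0 < volume (A \ {c}) := by rwa [measure_sdiff_null (measure_singleton c)]
      exact hAc.trans_le (measure_mono fun x hx => ⟨(hpt x hx.2).ne', hx.1⟩)
    · refine Filter.Eventually.of_forall fun x => ?_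
      rcases eq_or_ne x c with rfl | hx
      · simp
      · exact (hpt x hx).le
  rw [integral_sub hi₁.integrableOn hi₂.integrableOn, integral_const_mul, integral_const_mul,
    setIntegral_sub_mul hpos hint hmean hA,
    hmp.setIntegral_preimage_emb (measurableEmbedding_addRight t) (fun y => (y - (c + t)) * f y) B,
    setIntegral_sub_mul hpos hint hmean hB, ← hc] at hI
  simp only [sub_self, zero_mul, mul_zero, zero_sub] at hI
  have h₁ := setIntegral_density_pos hpos hint hB
  by_contra! hcon
  have := mul_nonneg (hpos c).le (mul_nonneg (sub_nonneg.2 hcon) h₁.le)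
  linarith

end ConditionalMean

section Bins

variable {f : ℝ → ℝ} {lo hi lo' hi' : EReal}

lemma measurableSet_ebin : MeasurableSet (ebin lo hi) :=
  (measurableSet_le measurable_const measurable_coe_real_ereal).inter
    (measurableSet_lt measurable_coe_real_ereal measurable_const)

lemma volume_ebin_pos (h : lo < hi) : 0 < volume (ebin lo hi) := by
  obtain ⟨p, hp, hp'⟩ := EReal.lt_iff_exists_real_btwn.1 h
  obtain ⟨q, hq, hq'⟩ := EReal.lt_iff_exists_real_btwn.1 hp'
  refine ((Measure.measure_Ioo_pos volume).2 (EReal.coe_lt_coe_iff.1 hq)).trans_le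
    (measure_mono fun x hx => ⟨?_, ?_⟩)
  · exact hp.le.trans (EReal.coe_le_coe_iff.2 hx.1.le)
  · exact (EReal.coe_lt_coe_iff.2 hx.2).trans hq'

lemma preimage_add_ebin (t : ℝ) :
    (fun x => x + t) ⁻¹' ebin (lo + t) (hi + t) = ebin lo hi := by
  ext x
  simp only [ebin, mem_preimage, mem_ofPred_eq, EReal.coe_add]
  refine and_congr ?_ ?_
  · induction lo
    · simp
    · norm_cast
      simp
    · simp [← EReal.coe_add]
  · induction hi
    · simp
    · norm_cast
      simp
    · simp [← EReal.coe_add, EReal.coe_lt_top]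

/-- The conditional mean on the bin `[lo, hi)`, extended to empty bins by the position of the
bin. -/
noncomputable def binMean (f : ℝ → ℝ) (lo hi : EReal) : ℝ :=
  open Classical in if lo < hi then condMean f (ebin lo hi) else lo.toReal

lemma binMean_of_lt (h : lo < hi) : binMean f lo hi = condMean f (ebin lo hi) := if_pos h

@[simp] lemma binMean_self (f : ℝ → ℝ) (x : ℝ) : binMean f x x = x := by simp [binMean]

lemma eq_coe_of_le_of_not_lt (h : lo ≤ hi) (hlo : lo ≠ ⊤) (hhi : hi ≠ ⊥) (hn : ¬ lo < hi) :
    ∃ x : ℝ, lo = x ∧ hi = x := by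
  obtain rfl := h.eq_of_not_lt hn
  exact ⟨lo.toReal, (EReal.coe_toReal hlo hhi).symm, (EReal.coe_toReal hlo hhi).symm⟩

variable (hpos : ∀ x, 0 < f x) (hint : Integrable f) (hmean : Integrable fun x => x * f x)
include hpos hint hmean

lemma binMean_lt (h : lo < hi) : (binMean f lo hi : EReal) < hi := by
  rw [binMean_of_lt h]
  induction hi
  · simp at h
  · exact EReal.coe_lt_coe_iff.2 (condMean_lt_of_forall_lt hpos hint hmean measurableSet_ebin
      (volume_ebin_pos h) fun x hx => EReal.coe_lt_coe_iff.1 hx.2)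
  · exact EReal.coe_lt_top _

lemma binMean_le (h : lo ≤ hi) (hlo : lo ≠ ⊤) (hhi : hi ≠ ⊥) :
    (binMean f lo hi : EReal) ≤ hi := by
  by_cases hlt : lo < hi
  · exact (binMean_lt hpos hint hmean hlt).le
  · obtain ⟨x, rfl, rfl⟩ := eq_coe_of_le_of_not_lt h hlo hhi hlt
    simp

lemma le_binMean (h : lo ≤ hi) (hlo : lo ≠ ⊤) (hhi : hi ≠ ⊥) :
    lo ≤ (binMean f lo hi : EReal) := by
  by_cases hlt : lo < hi
  · rw [binMean_of_lt hlt]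
    induction lo
    · exact bot_le
    · exact EReal.coe_le_coe_iff.2 (le_condMean_of_forall_le hpos hint hmean measurableSet_ebin
        (volume_ebin_pos hlt) fun x hx => EReal.coe_le_coe_iff.1 hx.1)
    · exact absurd rfl hlo
  · obtain ⟨x, rfl, rfl⟩ := eq_coe_of_le_of_not_lt h hlo hhi hlt
    simp

lemma binMean_mono (h : lo ≤ hi) (hlo : lo ≠ ⊤) (hhi : hi ≠ ⊥) (h' : lo' ≤ hi') (hlo' : lo' ≠ ⊤)
    (hhi' : hi' ≠ ⊥) (hl : lo ≤ lo') (hh : hi ≤ hi') : binMean f lo hi ≤ binMean f lo' hi' := by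
  have hle := binMean_le hpos hint hmean h hlo hhi
  have hle' := le_binMean hpos hint hmean h' hlo' hhi'
  by_cases hc : (binMean f lo hi : EReal) ≤ lo'
  · exact EReal.coe_le_coe_iff.1 (hc.trans hle')
  by_cases hlt : lo < hi
  · by_cases hlt' : lo' < hi'
    · rw [binMean_of_lt hlt] at *
      rw [binMean_of_lt hlt'] at *
      refine condMean_le_condMean hpos hint hmean measurableSet_ebin measurableSet_ebin
        (volume_ebin_pos hlt) (volume_ebin_pos hlt') (fun x hx hx' => ?_) fun x hx hx' => ?_
      · have : (x : EReal) < lo' := by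
          by_contra! hge
          exact hx' ⟨hge, hx.2.trans_le hh⟩
        exact (EReal.coe_lt_coe_iff.1 (this.trans (not_le.1 hc))).le
      · have : hi ≤ (x : EReal) := by
          by_contra! hge
          exact hx' ⟨hl.trans hx.1, hge⟩
        exact EReal.coe_le_coe_iff.1 (hle.trans this)
    · obtain ⟨x, rfl, rfl⟩ := eq_coe_of_le_of_not_lt h' hlo' hhi' hlt'
      exact absurd (hle.trans hh) hc
  · obtain ⟨x, rfl, rfl⟩ := eq_coe_of_le_of_not_lt h hlo hhi hlt
    exact absurd (by simpa using hl) hc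

lemma binMean_add_lt (hslc : StrictConcaveOn ℝ univ fun x => Real.log (f x)) (h : lo < hi)
    {t : ℝ} (ht : 0 < t) : binMean f (lo + t) (hi + t) < binMean f lo hi + t := by
  have h' := EReal.add_lt_add_right_coe h t
  rw [binMean_of_lt h, binMean_of_lt h', ← preimage_add_ebin t (lo := lo)]
  exact condMean_lt_condMean_preimage_add hpos hint hmean hslc measurableSet_ebin ht
    (volume_ebin_pos h')

end Bins

section Edges

variable {N : ℕ} {m m' : Fin (N - 1) → ℝ} {k : ℕ}

@[simp] lemma edges2_zero (m : Fin (N - 1) → ℝ) : edges2 N m 0 = ⊥ := by simp [edges2]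

@[simp] lemma edges2_succ (m : Fin (N - 1) → ℝ) (k : Fin (N - 1)) :
    edges2 N m (k + 1) = m k := by
  have : (k : ℕ) + 1 ≤ N - 1 := k.2
  simp [edges2, this]

lemma edges2_succ_of_lt (m : Fin (N - 1) → ℝ) (hk : k < N - 1) :
    edges2 N m (k + 1) = m ⟨k, hk⟩ := edges2_succ m ⟨k, hk⟩

lemma edges2_succ_of_le (m : Fin (N - 1) → ℝ) (hk : N - 1 ≤ k) : edges2 N m (k + 1) = ⊤ := by
  have : ¬ k + 1 ≤ N - 1 := by omega
  simp [edges2, this]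

lemma edges2_succ_ne_bot (m : Fin (N - 1) → ℝ) (k : ℕ) : edges2 N m (k + 1) ≠ ⊥ := by
  rcases lt_or_ge k (N - 1) with h | h
  · simp [edges2_succ_of_lt m h]
  · simp [edges2_succ_of_le m h]

lemma edges2_ne_top (m : Fin (N - 1) → ℝ) (hk : k ≤ N - 1) : edges2 N m k ≠ ⊤ := by
  cases k with
  | zero => simp
  | succ k => simp [edges2_succ_of_lt m hk]

lemma edges2_monotone (hm : Monotone m) : Monotone (edges2 N m) := by
  refine monotone_nat_of_le_succ fun k => ?_
  cases k with
  | zero => simp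
  | succ k =>
    rcases lt_or_ge (k + 1) (N - 1) with h | h
    · rw [edges2_succ_of_lt m h, edges2_succ_of_lt m (by omega : k < N - 1)]
      exact EReal.coe_le_coe_iff.2 (hm (Fin.mk_le_mk.2 k.le_succ))
    · rw [edges2_succ_of_le m h]
      exact le_top

lemma edges2_lt_succ (hm : StrictMono m) (hk : k ≤ N - 1) :
    edges2 N m k < edges2 N m (k + 1) := by
  cases k with
  | zero => simpa using bot_lt_iff_ne_bot.2 (edges2_succ_ne_bot m 0)
  | succ k =>
    rcases lt_or_ge (k + 1) (N - 1) with h | h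
    · rw [edges2_succ_of_lt m h, edges2_succ_of_lt m (by omega : k < N - 1)]
      exact EReal.coe_lt_coe_iff.2 (hm (Fin.mk_lt_mk.2 k.lt_succ_self))
    · rw [edges2_succ_of_le m h]
      exact lt_top_iff_ne_top.2 (edges2_ne_top m hk)

lemma strictMono_of_edges2_lt_succ (hm : Monotone m)
    (h : ∀ k ≤ N - 1, edges2 N m k < edges2 N m (k + 1)) : StrictMono m := by
  intro i j hij
  have h₁ : edges2 N m (i + 1) < edges2 N m (j + 1) :=
    (h _ i.2).trans_le (edges2_monotone hm (Nat.succ_le_succ hij))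
  simpa using h₁

lemma edges2_le_edges2_add {t : ℝ} (h : ∀ k, m k ≤ m' k + t) (k : ℕ) :
    edges2 N m k ≤ edges2 N m' k + t := by
  cases k with
  | zero => simp
  | succ k =>
    rcases lt_or_ge k (N - 1) with hk | hk
    · rw [edges2_succ_of_lt m hk, edges2_succ_of_lt m' hk]
      exact_mod_cast h _
    · rw [edges2_succ_of_le m' hk, EReal.top_add_coe]
      exact le_top

lemma edges2_le_edges2 (h : m ≤ m') (k : ℕ) : edges2 N m k ≤ edges2 N m' k := by
  simpa using edges2_le_edges2_add (t := 0) (fun j => by simpa using h j) k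

end Edges

section EquilibriumMap

variable {f : ℝ → ℝ} {b : ℝ} {N : ℕ} {m m' : Fin (N - 1) → ℝ}

/-- The map on edge vectors whose strictly increasing fixed points are the equilibria. -/
noncomputable def equilibriumMap (f : ℝ → ℝ) (b : ℝ) (N : ℕ) (m : Fin (N - 1) → ℝ) :
    Fin (N - 1) → ℝ := fun k =>
  (binMean f (edges2 N m k) (edges2 N m (k + 1)) +
    binMean f (edges2 N m (k + 1)) (edges2 N m (k + 2))) / 2 + b

lemma isEq2_iff : IsEq2 f b N m ↔ StrictMono m ∧ equilibriumMap f b N m = m := by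
  refine and_congr_right fun hm => ?_
  rw [eq_comm, funext_iff]
  refine forall_congr' fun k => ?_
  have h₁ := edges2_lt_succ hm k.2.le
  have h₂ := edges2_lt_succ hm (k := k + 1) k.2
  rw [equilibriumMap, binMean_of_lt h₁, binMean_of_lt h₂]

variable (hpos : ∀ x, 0 < f x) (hint : Integrable f) (hmean : Integrable fun x => x * f x)
include hpos hint hmean

lemma binMean_edges2_le (hm : Monotone m) (hm' : Monotone m') {i j : ℕ} (hi : i ≤ N - 1)
    (hj : j ≤ N - 1) (h₁ : edges2 N m i ≤ edges2 N m' j)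
    (h₂ : edges2 N m (i + 1) ≤ edges2 N m' (j + 1)) :
    binMean f (edges2 N m i) (edges2 N m (i + 1)) ≤
      binMean f (edges2 N m' j) (edges2 N m' (j + 1)) :=
  binMean_mono hpos hint hmean (edges2_monotone hm i.le_succ) (edges2_ne_top m hi)
    (edges2_succ_ne_bot m i) (edges2_monotone hm' j.le_succ) (edges2_ne_top m' hj)
    (edges2_succ_ne_bot m' j) h₁ h₂

lemma equilibriumMap_le_equilibriumMap (hm : Monotone m) (hm' : Monotone m') (h : m ≤ m') :
    equilibriumMap f b N m ≤ equilibriumMap f b N m' := by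
  intro k
  have h₁ := binMean_edges2_le hpos hint hmean hm hm' k.2.le k.2.le (edges2_le_edges2 h _)
    (edges2_le_edges2 h _)
  have h₂ := binMean_edges2_le hpos hint hmean hm hm' k.2 k.2 (edges2_le_edges2 h _)
    (edges2_le_edges2 h _)
  simp only [equilibriumMap]
  linarith

lemma monotone_equilibriumMap (hm : Monotone m) : Monotone (equilibriumMap f b N m) := by
  intro i j hij
  have hij' : (i : ℕ) ≤ j := hij
  have h₁ := binMean_edges2_le hpos hint hmean hm hm i.2.le j.2.le
    (edges2_monotone hm hij') (edges2_monotone hm (by omega))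
  have h₂ := binMean_edges2_le hpos hint hmean hm hm i.2 j.2
    (edges2_monotone hm (Nat.succ_le_succ hij')) (edges2_monotone hm (by omega))
  simp only [equilibriumMap]
  linarith

lemma strictMono_of_equilibriumMap_eq (hm : Monotone m) (hfix : equilibriumMap f b N m = m) :
    StrictMono m := by
  refine strictMono_of_edges2_lt_succ hm fun k => ?_
  induction k with
  | zero => exact fun _ => by simpa using bot_lt_iff_ne_bot.2 (edges2_succ_ne_bot m 0)
  | succ k ih =>
    intro hk
    have hlt := ih (by omega)
    by_contra hn
    have heq := (edges2_monotone hm (k + 1).le_succ).eq_of_not_lt hn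
    rcases lt_or_ge (k + 1) (N - 1) with h | h
    · have hk' : k < N - 1 := by omega
      have e₁ := congrFun hfix ⟨k, hk'⟩
      have e₂ := congrFun hfix ⟨k + 1, h⟩
      have b₁ := binMean_lt hpos hint hmean hlt
      have b₂ := le_binMean hpos hint hmean (edges2_monotone hm (k + 2).le_succ)
        (edges2_ne_top m h) (edges2_succ_ne_bot m (k + 2))
      simp only [equilibriumMap] at e₁ e₂
      simp only [Nat.succ_eq_add_one, add_assoc, Nat.reduceAdd] at *
      rw [show k + 2 = (k + 1) + 1 from rfl, edges2_succ_of_lt m h, edges2_succ_of_lt m hk'] at heq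
      nth_rw 2 [edges2_succ_of_lt m hk'] at b₁
      nth_rw 1 [show k + 2 = (k + 1) + 1 from rfl, edges2_succ_of_lt m h] at b₂
      rw [EReal.coe_eq_coe_iff] at heq
      rw [EReal.coe_lt_coe_iff] at b₁
      rw [EReal.coe_le_coe_iff] at b₂
      linarith
    · rw [Nat.succ_eq_add_one, edges2_succ_of_le m h] at heq
      exact edges2_ne_top m hk heq

/-- Maximum principle: subsolutions of the equilibrium equations lie below supersolutions. -/
lemma le_of_le_equilibriumMap (hslc : StrictConcaveOn ℝ univ fun x => Real.log (f x))
    (hm : Monotone m) (hm' : StrictMono m') (hsub : m ≤ equilibriumMap f b N m)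
    (hsup : equilibriumMap f b N m' ≤ m') : m ≤ m' := by
  by_contra hcon
  obtain ⟨i, hi⟩ := not_forall.1 hcon
  have : Nonempty (Fin (N - 1)) := ⟨i⟩
  obtain ⟨k, hk⟩ := Finite.exists_max fun j => m j - m' j
  set t := m k - m' k with ht
  have ht0 : 0 < t := (sub_pos.2 (not_le.1 hi)).trans_le (hk i)
  have hle := edges2_le_edges2_add (m := m) (m' := m') (t := t) fun j => by
    have := hk j
    linarith
  have key : ∀ j ≤ N - 1, binMean f (edges2 N m j) (edges2 N m (j + 1)) <
      binMean f (edges2 N m' j) (edges2 N m' (j + 1)) + t := by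
    intro j hj
    have hlt := edges2_lt_succ hm' hj
    refine (binMean_mono hpos hint hmean (edges2_monotone hm j.le_succ) (edges2_ne_top m hj)
      (edges2_succ_ne_bot m j) (EReal.add_lt_add_right_coe hlt t).le ?_ ?_ (hle j)
      (hle (j + 1))).trans_lt (binMean_add_lt hpos hint hmean hslc hlt ht0)
    · exact EReal.add_ne_top (edges2_ne_top m' hj) (EReal.coe_ne_top t)
    · simpa [EReal.add_eq_bot_iff] using edges2_succ_ne_bot m' j
  have h₁ := key k k.2.le
  have h₂ := key (k + 1) k.2
  have h₃ := hsub k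
  have h₄ := hsup k
  simp only [equilibriumMap] at h₃ h₄
  linarith

lemma exists_strictMono_equilibriumMap_le
    (hslc : StrictConcaveOn ℝ univ fun x => Real.log (f x)) :
    ∃ m : Fin (N - 1) → ℝ, StrictMono m ∧ equilibriumMap f b N m ≤ m := by
  set R := binMean f ((0 : ℝ) : EReal) ⊤ with hR
  set μ := binMean f ⊥ ⊤ with hμ
  have hR0 : 0 ≤ R := EReal.coe_le_coe_iff.1
    (le_binMean hpos hint hmean le_top (EReal.coe_ne_top 0) top_ne_bot)
  have hbound : ∀ x : ℝ, 0 ≤ x → binMean f x ⊤ ≤ x + R := by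
    intro x hx
    rcases hx.eq_or_lt with rfl | hx
    · simp [hR]
    · have := binMean_add_lt hpos hint hmean hslc (EReal.coe_lt_top 0) hx
      rw [← EReal.coe_add, zero_add, EReal.top_add_coe] at this
      linarith
  have hb := le_abs_self b
  have hb0 := abs_nonneg b
  have hμ' := le_abs_self μ
  have hμ0 := abs_nonneg μ
  set D := 2 * R + 2 * |b| + 1
  set m : Fin (N - 1) → ℝ := fun k => |μ| + R + 2 * |b| + (k : ℕ) * D with hm
  have hD0 : 0 < D := by linarith
  have hmono : StrictMono m := fun i j hij => by
    have : ((i : ℕ) : ℝ) < (j : ℕ) := by exact_mod_cast hij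
    simp only [hm]
    nlinarith
  have hm0 : ∀ k, 0 ≤ m k := fun k => by positivity
  refine ⟨m, hmono, fun k => ?_⟩
  have hle : ∀ j ≤ N - 1, binMean f (edges2 N m j) (edges2 N m (j + 1)) ≤
      binMean f (edges2 N m j) ⊤ := fun j hj =>
    binMean_mono hpos hint hmean (edges2_monotone hmono.monotone j.le_succ) (edges2_ne_top m hj)
      (edges2_succ_ne_bot m j) le_top (edges2_ne_top m hj) top_ne_bot le_rfl le_top
  have h₁ : binMean f (edges2 N m k) (edges2 N m (k + 1)) ≤ m k - R - 2 * |b| := by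
    refine (hle k k.2.le).trans ?_
    obtain ⟨k, hk⟩ := k
    cases k with
    | zero =>
      simp only [edges2_zero, ← hμ, hm]
      push_cast
      linarith
    | succ k =>
      have hk' : k < N - 1 := by omega
      have := hbound _ (hm0 ⟨k, hk'⟩)
      rw [edges2_succ_of_lt m hk']
      have hsucc : m ⟨k + 1, hk⟩ = m ⟨k, hk'⟩ + D := by
        simp only [hm]
        push_cast
        ring
      rw [hsucc]
      linarith
  have h₂ : binMean f (edges2 N m (k + 1)) (edges2 N m (k + 2)) ≤ m k + R := by
    refine (hle (k + 1) k.2).trans ?_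
    rw [edges2_succ]
    exact hbound _ (hm0 k)
  simp only [equilibriumMap]
  linarith

lemma exists_strictMono_le_equilibriumMap
    (hslc : StrictConcaveOn ℝ univ fun x => Real.log (f x)) :
    ∃ m : Fin (N - 1) → ℝ, StrictMono m ∧ m ≤ equilibriumMap f b N m := by
  set R := -binMean f ⊥ ((0 : ℝ) : EReal) with hR
  set μ := binMean f ⊥ ⊤ with hμ
  have hR0 : 0 < R := neg_pos.2 (EReal.coe_lt_coe_iff.1
    (binMean_lt hpos hint hmean (EReal.bot_lt_coe 0)))
  have hbound : ∀ x : ℝ, x ≤ 0 → x - R ≤ binMean f ⊥ x := by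
    intro x hx
    rcases hx.eq_or_lt with rfl | hx
    · simp [hR]
    · have := binMean_add_lt hpos hint hmean hslc (EReal.bot_lt_coe x) (neg_pos.2 hx)
      rw [← EReal.coe_add, add_neg_cancel, EReal.bot_add] at this
      linarith
  have hb := neg_abs_le b
  have hb0 := abs_nonneg b
  have hμ' := neg_abs_le μ
  have hμ0 := abs_nonneg μ
  set D := 2 * R + 2 * |b| + 1
  set m : Fin (N - 1) → ℝ := fun k => -(|μ| + R + 2 * |b| + (N - (k : ℕ)) * D) with hm
  have hD0 : 0 < D := by linarith
  have hmono : StrictMono m := fun i j hij => by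
    have : ((i : ℕ) : ℝ) < (j : ℕ) := by exact_mod_cast hij
    simp only [hm]
    nlinarith
  have hmle : ∀ k, m k ≤ -(|μ| + R + 2 * |b|) := fun k => by
    have hk : (k : ℕ) ≤ N := by omega
    have : (0 : ℝ) ≤ N - (k : ℕ) := sub_nonneg.2 (by exact_mod_cast hk)
    have := mul_nonneg this hD0.le
    simp only [hm]
    linarith
  have hm0 : ∀ k, m k ≤ 0 := fun k => by
    have := hmle k
    linarith
  refine ⟨m, hmono, fun k => ?_⟩
  have hle : ∀ j ≤ N - 1, binMean f ⊥ (edges2 N m (j + 1)) ≤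
      binMean f (edges2 N m j) (edges2 N m (j + 1)) := fun j hj =>
    binMean_mono hpos hint hmean bot_le bot_ne_top (edges2_succ_ne_bot m j)
      (edges2_monotone hmono.monotone j.le_succ) (edges2_ne_top m hj)
      (edges2_succ_ne_bot m j) bot_le le_rfl
  have h₁ : m k - R ≤ binMean f (edges2 N m k) (edges2 N m (k + 1)) := by
    refine le_trans ?_ (hle k k.2.le)
    rw [edges2_succ]
    exact hbound _ (hm0 k)
  have h₂ : m k + R + 2 * |b| ≤ binMean f (edges2 N m (k + 1)) (edges2 N m (k + 2)) := by
    refine le_trans ?_ (hle (k + 1) k.2)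
    rcases lt_or_ge ((k : ℕ) + 1) (N - 1) with hk | hk
    · have := hbound _ (hm0 ⟨k + 1, hk⟩)
      rw [edges2_succ_of_lt m hk]
      have hsucc : m ⟨k + 1, hk⟩ = m k + D := by
        simp only [hm]
        push_cast
        ring
      rw [hsucc] at this ⊢
      linarith
    · rw [edges2_succ_of_le m hk]
      have := hmle k
      linarith
  simp only [equilibriumMap]
  linarith

/-- The supremum of all monotone subsolutions is a fixed point of `equilibriumMap`. -/
lemma exists_monotone_equilibriumMap_eq
    (hslc : StrictConcaveOn ℝ univ fun x => Real.log (f x)) :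
    ∃ m : Fin (N - 1) → ℝ, Monotone m ∧ equilibriumMap f b N m = m := by
  obtain ⟨u, hu, hu'⟩ :=
    exists_strictMono_equilibriumMap_le (b := b) (N := N) hpos hint hmean hslc
  obtain ⟨l, hl, hl'⟩ :=
    exists_strictMono_le_equilibriumMap (b := b) (N := N) hpos hint hmean hslc
  set S : Set (Fin (N - 1) → ℝ) := {m | Monotone m ∧ m ≤ equilibriumMap f b N m}
  have hne : S.Nonempty := ⟨l, hl.monotone, hl'⟩
  have hbdd : BddAbove S :=
    ⟨u, fun m hm => le_of_le_equilibriumMap hpos hint hmean hslc hm.1 hu hm.2 hu'⟩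
  have hlub := isLUB_csSup hne hbdd
  set s := sSup S
  have hs : Monotone s := by
    intro i j hij
    have hi := (isLUB_pi.1 hlub) i
    have hj := (isLUB_pi.1 hlub) j
    refine hi.2 ?_
    rintro _ ⟨m, hm, rfl⟩
    exact (hm.1 hij).trans (hj.1 ⟨m, hm, rfl⟩)
  have hle : s ≤ equilibriumMap f b N s := hlub.2 fun m hm =>
    hm.2.trans (equilibriumMap_le_equilibriumMap hpos hint hmean hm.1 hs (hlub.1 hm))
  have hs' := monotone_equilibriumMap (b := b) hpos hint hmean hs
  exact ⟨s, hs, le_antisymm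
    (hlub.1 ⟨hs', equilibriumMap_le_equilibriumMap hpos hint hmean hs hs' hle⟩) hle⟩

end EquilibriumMap

/-- For a source with an everywhere positive, strictly log-concave density on
`ℝ` with finite mean, and any bias `b`, for every `N ≥ 2` there exists a unique `N`-bin
cheap-talk equilibrium. -/
theorem logConcave_twoSided_unique_equilibrium (f : ℝ → ℝ) (b : ℝ)
    (hpos : ∀ x, 0 < f x)
    (hint : Integrable f)
    (hpdf : ∫ x, f x = 1)
    (hslc : StrictConcaveOn ℝ Set.univ (fun x => Real.log (f x)))
    (hmean : Integrable (fun x => x * f x)) :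
    ∀ N : ℕ, 2 ≤ N → ∃! m : Fin (N - 1) → ℝ, IsEq2 f b N m := by
  intro N _
  obtain ⟨m, hm, hfix⟩ :=
    exists_monotone_equilibriumMap_eq (b := b) (N := N) hpos hint hmean hslc
  have hsm := strictMono_of_equilibriumMap_eq hpos hint hmean hm hfix
  refine ⟨m, isEq2_iff.2 ⟨hsm, hfix⟩, fun m' hm' => ?_⟩
  obtain ⟨hsm', hfix'⟩ := isEq2_iff.1 hm'
  exact le_antisymm
    (le_of_le_equilibriumMap hpos hint hmean hslc hsm'.monotone hsm hfix'.ge hfix.le)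
    (le_of_le_equilibriumMap hpos hint hmean hslc hm hsm' hfix.ge hfix'.le)
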